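/- Let s₀ ∈ (0, 1/8] and let ṽ : (0, s₀) → ℝ be differentiable with ṽ(s) > 0 and ṽ'(s) = s/ṽ(s) − 1/√(2s) for all s ∈ (0, s₀), and suppose Γ_μ(s) ≤ ṽ(s) ≤ √2 · s^{3/2} for every μ ∈ (0, √2) and every s ∈ (0, s₀). Then √2 s^{3/2} − 3√2 s^{5/2} ≤ ṽ(s) ≤ √2 s^{3/2} − 3√2 s^{5/2} + 24√2 s^{7/2} for all s ∈ (0, s₀). -/

import Mathlib

/-- The lower barrier `Γ_μ`: for `μ ∈ (0, √2)` and `δ_μ := μ/(3√2)`,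
`Γ_μ(s) = (√2 - μ) s^{3/2}` for `s ≤ δ_μ` and `Γ_μ(s) = (√2 - μ) δ_μ^{3/2}` for `s > δ_μ`. -/
noncomputable def Gamma (μ s : ℝ) : ℝ :=
  if s ≤ μ / (3 * Real.sqrt 2) then (Real.sqrt 2 - μ) * s ^ ((3:ℝ)/2)
  else (Real.sqrt 2 - μ) * (μ / (3 * Real.sqrt 2)) ^ ((3:ℝ)/2)

/-- The upper barrier `√2 s^{3/2} (1 - 3 s + 24 s²)`, written with a square root. -/
noncomputable def upperBarrier (s : ℝ) : ℝ :=
  √2 * (√s * (s - 3 * s ^ 2 + 24 * s ^ 3))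

theorem rpow_add_half {s : ℝ} (hs : 0 < s) (n : ℕ) {x : ℝ} (hx : x = n + 1 / 2) :
    s ^ x = √s * s ^ n := by
  rw [hx, Real.rpow_add hs, Real.rpow_natCast, Real.sqrt_eq_rpow, mul_comm]

theorem rpow_three_halves {s : ℝ} (hs : 0 < s) : s ^ ((3:ℝ)/2) = √s * s := by
  simpa using rpow_add_half hs 1 (x := 3 / 2) (by norm_num)

theorem rpow_five_halves {s : ℝ} (hs : 0 < s) : s ^ ((5:ℝ)/2) = √s * s ^ 2 :=
  rpow_add_half hs 2 (by norm_num)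

theorem rpow_seven_halves {s : ℝ} (hs : 0 < s) : s ^ ((7:ℝ)/2) = √s * s ^ 3 :=
  rpow_add_half hs 3 (by norm_num)

theorem hasDerivAt_upperBarrier {s : ℝ} (hs : 0 < s) :
    HasDerivAt upperBarrier
      (√2 * (1 / (2 * √s) * (s - 3 * s ^ 2 + 24 * s ^ 3) + √s * (1 - 6 * s + 72 * s ^ 2))) s := by
  have hp : HasDerivAt (fun s : ℝ => s - 3 * s ^ 2 + 24 * s ^ 3) (1 - 6 * s + 72 * s ^ 2) s := by
    have := ((hasDerivAt_id s).sub ((hasDerivAt_pow 2 s).const_mul 3)).add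
      ((hasDerivAt_pow 3 s).const_mul 24)
    refine this.congr_deriv ?_
    norm_num
    ring
  exact ((Real.hasDerivAt_sqrt hs.ne').mul hp).const_mul _

theorem upperBarrier_pos {s : ℝ} (hs : 0 < s) : 0 < upperBarrier s := by
  have hP : 0 < 1 - 3 * s + 24 * s ^ 2 := by nlinarith [sq_nonneg (s - 1 / 16)]
  have : upperBarrier s = √2 * √s * s * (1 - 3 * s + 24 * s ^ 2) := by
    unfold upperBarrier; ring
  rw [this]
  positivity

/-- The upper barrier is a supersolution of the singular ODE. -/
theorem upperBarrier_supersolution {s : ℝ} (hs : 0 < s) :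
    s / upperBarrier s - 1 / √(2 * s) ≤
      √2 * (1 / (2 * √s) * (s - 3 * s ^ 2 + 24 * s ^ 3) + √s * (1 - 6 * s + 72 * s ^ 2)) := by
  have hP : 0 < 1 - 3 * s + 24 * s ^ 2 := by nlinarith [sq_nonneg (s - 1 / 16)]
  have hr : 0 < √s := Real.sqrt_pos.2 hs
  have hq : 0 < √2 := by positivity
  have hr2 : √s ^ 2 = s := Real.sq_sqrt hs.le
  have hq2 : √2 ^ 2 = 2 := Real.sq_sqrt zero_le_two
  have hlhs : s / upperBarrier s - 1 / √(2 * s) =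
      1 / (√2 * √s) * (s * (3 - 24 * s) / (1 - 3 * s + 24 * s ^ 2)) := by
    have : upperBarrier s = √2 * √s * s * (1 - 3 * s + 24 * s ^ 2) := by
      unfold upperBarrier; ring
    rw [this, Real.sqrt_mul zero_le_two]
    have hnum : s * (3 - 24 * s) = 1 - (1 - 3 * s + 24 * s ^ 2) := by ring
    rw [hnum]
    generalize 1 - 3 * s + 24 * s ^ 2 = P at hP
    field_simp
  have hrhs : √2 * (1 / (2 * √s) * (s - 3 * s ^ 2 + 24 * s ^ 3) +
      √s * (1 - 6 * s + 72 * s ^ 2)) =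
      1 / (√2 * √s) * (s * (3 - 15 * s + 168 * s ^ 2)) := by
    field_simp
    rw [hr2, hq2]
    ring
  rw [hlhs, hrhs]
  gcongr
  rw [div_le_iff₀ hP, mul_assoc]
  gcongr
  nlinarith [mul_nonneg (sq_nonneg s) (sq_nonneg (s - 3 / 28)), sq_nonneg s]

/-- A solution with `v s ≤ √2 s^{3/2}` near `0` lies below the upper barrier. -/
theorem le_upperBarrier {s₀ : ℝ} {v : ℝ → ℝ}
    (hode : ∀ s ∈ Set.Ioo 0 s₀, HasDerivAt v (s / v s - 1 / √(2 * s)) s)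
    (hup : ∀ s ∈ Set.Ioo 0 s₀, v s ≤ √2 * (√s * s)) {s : ℝ} (hs : s ∈ Set.Ioo 0 s₀) :
    v s ≤ upperBarrier s := by
  refine le_of_forall_pos_le_add fun ε hε => ?_
  obtain ⟨a, ha0, ha⟩ : ∃ a, 0 < a ∧ a < min s (min 1 (ε / 6)) :=
    exists_between (lt_min hs.1 (lt_min one_pos (by positivity)))
  obtain ⟨has, ha1, haε⟩ : a < s ∧ a < 1 ∧ a < ε / 6 := by simpa only [lt_min_iff] using ha
  have hmem : ∀ x ∈ Set.Icc a s, x ∈ Set.Ioo 0 s₀ := fun x hx =>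
    ⟨ha0.trans_le hx.1, hx.2.trans_lt hs.2⟩
  have hB : ∀ x ∈ Set.Icc a s, HasDerivAt (fun x => upperBarrier x + ε) _ x := fun x hx =>
    (hasDerivAt_upperBarrier (hmem x hx).1).add_const ε
  refine image_le_of_deriv_right_lt_deriv_boundary'
    (B := fun x => upperBarrier x + ε)
    (fun x hx => (hode x (hmem x hx)).continuousAt.continuousWithinAt)
    (fun x hx => (hode x (hmem x (Set.Ico_subset_Icc_self hx))).hasDerivWithinAt) ?_
    (fun x hx => (hB x hx).continuousAt.continuousWithinAt)
    (fun x hx => (hB x (Set.Ico_subset_Icc_self hx)).hasDerivWithinAt) ?_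
    (Set.right_mem_Icc.2 has.le)
  · refine (hup a ⟨ha0, has.trans hs.2⟩).trans ?_
    have hq : √2 ≤ 2 := Real.sqrt_le_iff.2 ⟨by norm_num, by norm_num⟩
    have hr : √a ≤ 1 := Real.sqrt_le_one.2 ha1.le
    have hqr : √2 * √a ≤ 2 * 1 := by gcongr
    have h3 : √2 * √a * (3 * a ^ 2) ≤ 2 * 1 * (3 * a) := by
      gcongr
      nlinarith
    have h4 : 0 ≤ √2 * √a * (24 * a ^ 3) := by positivity
    simp only [upperBarrier]
    linarith
  · intro x hx hxB
    have hx0 := (hmem x (Set.Ico_subset_Icc_self hx)).1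
    refine lt_of_lt_of_le ?_ (upperBarrier_supersolution hx0)
    rw [hxB]
    have := upperBarrier_pos hx0
    gcongr
    linarith

/-- Second-order finite expansion of the solution `ṽ` of the singular ODE
`ṽ'(s) = s/ṽ(s) - 1/√(2s)`:
`√2 s^{3/2} - 3√2 s^{5/2} ≤ ṽ(s) ≤ √2 s^{3/2} - 3√2 s^{5/2} + 24√2 s^{7/2}`. -/
theorem stmt_6 (s₀ : ℝ) (hs₀ : s₀ ∈ Set.Ioc 0 (1/8 : ℝ)) (v : ℝ → ℝ)
    (hpos : ∀ s ∈ Set.Ioo 0 s₀, 0 < v s)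
    (hode : ∀ s ∈ Set.Ioo 0 s₀, HasDerivAt v (s / v s - 1 / Real.sqrt (2 * s)) s)
    (hbd : ∀ μ ∈ Set.Ioo 0 (Real.sqrt 2), ∀ s ∈ Set.Ioo 0 s₀,
      Gamma μ s ≤ v s ∧ v s ≤ Real.sqrt 2 * s ^ ((3:ℝ)/2)) :
    ∀ s ∈ Set.Ioo 0 s₀,
      Real.sqrt 2 * s ^ ((3:ℝ)/2) - 3 * Real.sqrt 2 * s ^ ((5:ℝ)/2) ≤ v s ∧
      v s ≤ Real.sqrt 2 * s ^ ((3:ℝ)/2) - 3 * Real.sqrt 2 * s ^ ((5:ℝ)/2)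
        + 24 * Real.sqrt 2 * s ^ ((7:ℝ)/2) := by
  intro s hs
  have hs8 : s < 1 / 8 := hs.2.trans_le hs₀.2
  have hq : 0 < √2 := by positivity
  constructor
  · have hδ : 3 * √2 * s / (3 * √2) = s := by field_simp
    have h := (hbd (3 * √2 * s) ⟨by have := hs.1; positivity, by nlinarith⟩ s hs).1
    rw [Gamma, hδ, if_pos le_rfl] at h
    rw [rpow_five_halves hs.1]
    rw [rpow_three_halves hs.1] at h ⊢
    linarith
  · have hμ : √2 / 2 ∈ Set.Ioo 0 √2 := ⟨by positivity, by linarith⟩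
    have h := le_upperBarrier hode (fun x hx => by
      simpa only [rpow_three_halves hx.1] using (hbd _ hμ x hx).2) hs
    rw [rpow_three_halves hs.1, rpow_five_halves hs.1, rpow_seven_halves hs.1]
    rw [upperBarrier] at h
    linarith
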